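/- arXiv:2203.05432 — 3 statements merged into one kernel-verified Lean document; each statement's English description precedes it below -/
import Mathlib

section
/- Let n and k be integers with k ≥ 1 and n > k+1, and let ω = ω_{n,k} be the largest real zero of T_n^{(k+1)}. Then τ_{n,k}² = ((2k-1)!!/(2k)!!) · (n/(n-k)) · (binom(n+k, n-k))⁻¹ · ((1-ω²)^k · S_{n,k+1}(ω))⁻¹. -/
open Polynomial Finset

/-- The odd double factorial `(2k-1)!! = 1·3·5⋯(2k-1)`. -/
noncomputable def oddDoubleFac (k : ℕ) : ℝ := ∏ j ∈ Finset.range k, (2 * (j : ℝ) + 1)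

/-- The even double factorial `(2k)!! = 2·4⋯(2k)`. -/
noncomputable def evenDoubleFac (k : ℕ) : ℝ := ∏ j ∈ Finset.range k, (2 * (j : ℝ) + 2)

/-- `S_{n,k}(x) = 1 + Σ_{m=1}^{k-1} ((2m-1)!!/(2m)!!) (k-m)_{2m} (1-x²)^{-m} ∏_{j=1}^m (n²-j²)⁻¹`. -/
noncomputable def S (n k : ℕ) (x : ℝ) : ℝ :=
  1 + ∑ m ∈ Finset.Icc 1 (k - 1),
    (oddDoubleFac m / evenDoubleFac m) *
      ((ascPochhammer ℝ (2 * m)).eval ((k : ℝ) - (m : ℝ))) *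
      ((1 - x ^ 2) ^ m)⁻¹ *
      ∏ j ∈ Finset.Icc 1 m, ((n : ℝ) ^ 2 - (j : ℝ) ^ 2)⁻¹

/-- The coefficient of `(1 - x²)^{-m}` in `S_{n,κ}(x)`, as a function of a real parameter `κ`. -/
noncomputable def sCoeff (n : ℕ) (κ : ℝ) (m : ℕ) : ℝ :=
  (oddDoubleFac m / evenDoubleFac m) * (ascPochhammer ℝ (2 * m)).eval (κ - m) *
    ∏ j ∈ Finset.Icc 1 m, ((n : ℝ) ^ 2 - (j : ℝ) ^ 2)⁻¹

lemma oddDoubleFac_pos (k : ℕ) : 0 < oddDoubleFac k :=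
  Finset.prod_pos fun _ _ => by positivity

lemma evenDoubleFac_pos (k : ℕ) : 0 < evenDoubleFac k :=
  Finset.prod_pos fun _ _ => by positivity

lemma natCast_sq_sub_natCast_sq_pos {n j : ℕ} (h : j < n) : 0 < (n : ℝ) ^ 2 - (j : ℝ) ^ 2 := by
  have : (j : ℝ) < n := by exact_mod_cast h
  nlinarith [(j.cast_nonneg : (0 : ℝ) ≤ j)]

lemma ascPochhammer_succ_eval_left (m : ℕ) (a : ℝ) :
    (ascPochhammer ℝ (m + 1)).eval a = a * (ascPochhammer ℝ m).eval (a + 1) := by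
  simp [ascPochhammer_succ_left]

lemma mul_ascPochhammer_eval_add_one (m : ℕ) (a : ℝ) :
    a * (ascPochhammer ℝ m).eval (a + 1) = (a + m) * (ascPochhammer ℝ m).eval a := by
  rw [← ascPochhammer_succ_eval_left, ascPochhammer_succ_eval, mul_comm]

lemma sCoeff_zero (n : ℕ) (κ : ℝ) : sCoeff n κ 0 = 1 := by
  simp [sCoeff, oddDoubleFac, evenDoubleFac]

lemma sCoeff_eq_zero {n k m : ℕ} (hm : 1 ≤ m) (hkm : k ≤ m) : sCoeff n k m = 0 := by
  have h : (ascPochhammer ℝ (2 * m)).eval ((k : ℝ) - m) = 0 := by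
    rw [ascPochhammer_eval_eq_zero_iff]
    exact ⟨m - k, by omega, by push_cast [Nat.cast_sub hkm]; ring⟩
  simp [sCoeff, h]

lemma sub_mul_sCoeff_add_one (n : ℕ) (κ : ℝ) (m : ℕ) :
    (κ - m) * sCoeff n (κ + 1) m = (κ + m) * sCoeff n κ m := by
  have h := mul_ascPochhammer_eval_add_one (2 * m) (κ - m)
  rw [show κ - (m : ℝ) + 1 = κ + 1 - m by ring] at h
  push_cast at h
  unfold sCoeff
  linear_combination (oddDoubleFac m / evenDoubleFac m) *
    (∏ j ∈ Finset.Icc 1 m, ((n : ℝ) ^ 2 - (j : ℝ) ^ 2)⁻¹) * h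

lemma sCoeff_recurrence (n : ℕ) (κ : ℝ) (m : ℕ) (hm : m + 1 < n) :
    ((n : ℝ) ^ 2 - (κ + 1) ^ 2) * sCoeff n (κ + 2) (m + 1) =
      (2 * κ + 1) * ((2 * m + 1) * sCoeff n (κ + 1) m - (2 * m + 3) * sCoeff n (κ + 1) (m + 1)) +
        ((n : ℝ) ^ 2 - κ ^ 2) * sCoeff n κ (m + 1) := by
  have hl := (natCast_sq_sub_natCast_sq_pos hm).ne'
  have he := (evenDoubleFac_pos m).ne'
  have hm2 : (2 * (m : ℝ) + 2) ≠ 0 := by positivity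
  unfold sCoeff
  rw [Finset.prod_Icc_succ_top (by omega : 1 ≤ m + 1)]
  have ho' : oddDoubleFac (m + 1) = oddDoubleFac m * (2 * m + 1) := by
    simp [oddDoubleFac, Finset.prod_range_succ]
  have he' : evenDoubleFac (m + 1) = evenDoubleFac m * (2 * m + 2) := by
    simp [evenDoubleFac, Finset.prod_range_succ]
  rw [ho', he', show 2 * (m + 1) = 2 * m + 1 + 1 by ring]
  set P := (ascPochhammer ℝ (2 * m)).eval (κ + 1 - m)
  have h₁ : (ascPochhammer ℝ (2 * m + 1 + 1)).eval (κ + 2 - ((m + 1 : ℕ) : ℝ)) =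
      P * (κ + m + 1) * (κ + m + 2) := by
    rw [ascPochhammer_succ_eval, ascPochhammer_succ_eval,
      show κ + 2 - ((m + 1 : ℕ) : ℝ) = κ + 1 - m by push_cast; ring]
    push_cast
    ring
  have h₂ : (ascPochhammer ℝ (2 * m + 1 + 1)).eval (κ + 1 - ((m + 1 : ℕ) : ℝ)) =
      (κ - m) * P * (κ + m + 1) := by
    rw [ascPochhammer_succ_eval, ascPochhammer_succ_eval_left,
      show κ + 1 - ((m + 1 : ℕ) : ℝ) + 1 = κ + 1 - m by push_cast; ring]
    push_cast
    ring
  have h₃ : (ascPochhammer ℝ (2 * m + 1 + 1)).eval (κ - ((m + 1 : ℕ) : ℝ)) =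
      (κ - m - 1) * (κ - m) * P := by
    rw [ascPochhammer_succ_eval_left, ascPochhammer_succ_eval_left,
      show κ - ((m + 1 : ℕ) : ℝ) + 1 + 1 = κ + 1 - m by push_cast; ring]
    push_cast
    ring
  rw [h₁, h₂, h₃]
  generalize (∏ j ∈ Finset.Icc 1 m, ((n : ℝ) ^ 2 - (j : ℝ) ^ 2)⁻¹) = Q
  field_simp
  push_cast
  ring

/-- The partial sums `∑_{m<N} s_m v^m`; for `N ≥ k ≥ 1` this is `S_{n,k}` with
`v = (1 - x²)⁻¹`. -/
noncomputable def sSum (n : ℕ) (κ v : ℝ) (N : ℕ) : ℝ :=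
  ∑ m ∈ Finset.range N, sCoeff n κ m * v ^ m

/-- The weighted partial sums `∑_{m<N} (κ + m) s_m v^m`. -/
noncomputable def sWeightedSum (n : ℕ) (κ v : ℝ) (N : ℕ) : ℝ :=
  ∑ m ∈ Finset.range N, (κ + m) * sCoeff n κ m * v ^ m

lemma sWeightedSum_add_one (n : ℕ) (κ v : ℝ) (N : ℕ) :
    sWeightedSum n (κ + 1) v N = (2 * κ + 1) * sSum n (κ + 1) v N - sWeightedSum n κ v N := by
  unfold sWeightedSum sSum
  rw [Finset.mul_sum, ← Finset.sum_sub_distrib]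
  refine Finset.sum_congr rfl fun m _ => ?_
  linear_combination -v ^ m * sub_mul_sCoeff_add_one n κ m

lemma sSum_add_two_with_boundary (n : ℕ) (κ v : ℝ) (N : ℕ) (hN : N < n) :
    ((n : ℝ) ^ 2 - (κ + 1) ^ 2) * sSum n (κ + 2) v (N + 1) =
      (v - 1) * (2 * κ + 1) *
          (2 * sWeightedSum n (κ + 1) v (N + 1) - (2 * κ + 1) * sSum n (κ + 1) v (N + 1)) +
        ((n : ℝ) ^ 2 - κ ^ 2) * sSum n κ v (N + 1) -
        (2 * κ + 1) * (2 * N + 1) * sCoeff n (κ + 1) N * v ^ (N + 1) := by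
  induction N with
  | zero =>
    simp [sSum, sWeightedSum, sCoeff_zero]
    ring
  | succ N ih =>
    have ih := ih (by omega)
    have h := sCoeff_recurrence n κ N hN
    simp only [sSum, sWeightedSum] at ih ⊢
    rw [Finset.sum_range_succ _ (N + 1), Finset.sum_range_succ _ (N + 1),
      Finset.sum_range_succ _ (N + 1), Finset.sum_range_succ _ (N + 1)]
    push_cast
    linear_combination ih + v ^ (N + 1) * h

lemma sSum_add_two (n k : ℕ) (v : ℝ) (N : ℕ) (hk : k + 2 ≤ N) (hN : N ≤ n) :
    ((n : ℝ) ^ 2 - (k + 1) ^ 2) * sSum n (k + 2) v N =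
      (v - 1) * (2 * k + 1) *
          (2 * sWeightedSum n (k + 1) v N - (2 * k + 1) * sSum n (k + 1) v N) +
        ((n : ℝ) ^ 2 - (k : ℝ) ^ 2) * sSum n k v N := by
  obtain ⟨M, rfl⟩ : ∃ M, N = M + 1 := ⟨N - 1, by omega⟩
  have h := sSum_add_two_with_boundary n k v M (by omega)
  have h0 := sCoeff_eq_zero (n := n) (k := k + 1) (m := M) (by omega) (by omega)
  push_cast at h0
  rw [h, h0]
  ring

lemma sum_range_eq_zeroth {f : ℕ → ℝ} {N : ℕ} (hN : 1 ≤ N) (hf : ∀ m, 1 ≤ m → f m = 0) :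
    ∑ m ∈ Finset.range N, f m = f 0 :=
  Finset.sum_eq_single_of_mem 0 (Finset.mem_range.2 hN) fun m _ hm => hf m (by omega)

lemma sSum_of_le_one {n k N : ℕ} (v : ℝ) (hk : k ≤ 1) (hN : 1 ≤ N) : sSum n k v N = 1 := by
  rw [sSum, sum_range_eq_zeroth hN fun m hm => by rw [sCoeff_eq_zero hm (hk.trans hm), zero_mul]]
  simp [sCoeff_zero]

lemma sWeightedSum_zero {n N : ℕ} (v : ℝ) (hN : 1 ≤ N) : sWeightedSum n 0 v N = 0 := by
  rw [sWeightedSum, sum_range_eq_zeroth hN fun m hm => by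
    have := sCoeff_eq_zero (n := n) hm (Nat.zero_le m)
    rw [Nat.cast_zero] at this
    rw [this, mul_zero, zero_mul]]
  simp

lemma sSum_eq_S (n k : ℕ) (x : ℝ) : sSum n (k + 1) (1 - x ^ 2)⁻¹ (k + 1) = S n (k + 1) x := by
  rw [sSum, S, Finset.range_eq_Ico, Finset.sum_eq_sum_Ico_succ_bot (by omega), sCoeff_zero]
  congr 1
  · simp
  · refine Finset.sum_congr rfl fun m _ => ?_
    rw [sCoeff, inv_pow]
    push_cast
    ring

/-- With `w = 1 - x²`, the numbers `w^{1/2-k} q_k` are the derivatives of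
`√(1 - x²) U_{n-1}`, the companion solution of the Chebyshev differential equation. -/
noncomputable def companion (n : ℕ) (x : ℝ) : ℕ → ℝ
  | 0 => (Chebyshev.U ℝ ((n : ℤ) - 1)).eval x
  | 1 => -n * (Chebyshev.T ℝ (n : ℤ)).eval x
  | k + 2 => (2 * k + 1) * x * companion n x (k + 1) -
      ((n : ℝ) ^ 2 - (k : ℝ) ^ 2) * (1 - x ^ 2) * companion n x k

lemma chebyshev_pell (n : ℤ) (x : ℝ) :
    (Chebyshev.T ℝ n).eval x ^ 2 + (1 - x ^ 2) * (Chebyshev.U ℝ (n - 1)).eval x ^ 2 = 1 := by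
  have h₁ := congrArg (eval (2 * x)) (Chebyshev.S_sq_add_S_sq ℝ (n - 1))
  have h₂ := fun m => congrArg (eval x) (Chebyshev.S_comp_two_mul_X ℝ m)
  have h₃ := congrArg (eval x) (Chebyshev.T_eq_U_sub_X_mul_U ℝ n)
  simp only [eval_comp, eval_mul, eval_ofNat, eval_X] at h₂
  simp only [eval_sub, eval_add, eval_mul, eval_pow, eval_X, eval_one, sub_add_cancel, h₂] at h₁ h₃
  rw [h₃]
  linear_combination h₁

lemma derivative_T_eval (n : ℕ) (x : ℝ) :
    (derivative^[1] (Chebyshev.T ℝ (n : ℤ))).eval x =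
      n * (Chebyshev.U ℝ ((n : ℤ) - 1)).eval x := by
  simp [Chebyshev.T_derivative_eq_U]

/-- The Wronskian of the two solutions, up to a power of `1 - x²`. -/
lemma wronskian_eq (n : ℕ) (x : ℝ) (k : ℕ) :
    (derivative^[k] (Chebyshev.T ℝ (n : ℤ))).eval x * companion n x (k + 1) -
      (1 - x ^ 2) * (derivative^[k + 1] (Chebyshev.T ℝ (n : ℤ))).eval x * companion n x k =
      -n * ∏ j ∈ Finset.range k, ((n : ℝ) ^ 2 - (j : ℝ) ^ 2) := by
  induction k with
  | zero =>
    simp only [zero_add, derivative_T_eval, companion, Function.iterate_zero, id, Finset.range_zero,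
      Finset.prod_empty]
    linear_combination -(n : ℝ) * chebyshev_pell n x
  | succ k ih =>
    have h := Chebyshev.one_sub_X_sq_mul_iterate_derivative_T_eval (R := ℝ) n k x
    rw [Finset.prod_range_succ, companion]
    push_cast at h
    linear_combination ((n : ℝ) ^ 2 - (k : ℝ) ^ 2) * ih - companion n x (k + 1) * h

/-- The sum of squares of the `k`-th derivatives of the two solutions, up to a power of
`1 - x²`. -/
noncomputable def squareSum (n : ℕ) (x : ℝ) (k : ℕ) : ℝ :=
  (1 - x ^ 2) ^ (2 * k) * (derivative^[k] (Chebyshev.T ℝ (n : ℤ))).eval x ^ 2 +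
    (1 - x ^ 2) * companion n x k ^ 2

/-- The mixed sum of products of the `k`-th and `(k+1)`-st derivatives of the two solutions,
up to a power of `1 - x²`. -/
noncomputable def crossSum (n : ℕ) (x : ℝ) (k : ℕ) : ℝ :=
  (1 - x ^ 2) ^ (2 * k + 1) * (derivative^[k] (Chebyshev.T ℝ (n : ℤ))).eval x *
      (derivative^[k + 1] (Chebyshev.T ℝ (n : ℤ))).eval x +
    (1 - x ^ 2) * companion n x k * companion n x (k + 1)

lemma crossSum_succ (n : ℕ) (x : ℝ) (k : ℕ) :
    crossSum n x (k + 1) = (2 * k + 1) * x * squareSum n x (k + 1) -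
      ((n : ℝ) ^ 2 - (k : ℝ) ^ 2) * (1 - x ^ 2) * crossSum n x k := by
  have h := Chebyshev.one_sub_X_sq_mul_iterate_derivative_T_eval (R := ℝ) n k x
  push_cast at h
  simp only [crossSum, squareSum, companion]
  linear_combination (1 - x ^ 2) ^ (2 * k + 2) *
    (derivative^[k + 1] (Chebyshev.T ℝ (n : ℤ))).eval x * h

lemma squareSum_add_two (n : ℕ) (x : ℝ) (k : ℕ) :
    squareSum n x (k + 2) = ((2 * k + 1) * x) ^ 2 * squareSum n x (k + 1) -
      2 * ((2 * k + 1) * x) * ((n : ℝ) ^ 2 - (k : ℝ) ^ 2) * (1 - x ^ 2) * crossSum n x k +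
      (((n : ℝ) ^ 2 - (k : ℝ) ^ 2) * (1 - x ^ 2)) ^ 2 * squareSum n x k := by
  have h := Chebyshev.one_sub_X_sq_mul_iterate_derivative_T_eval (R := ℝ) n k x
  push_cast at h
  have h2 := congrArg (· ^ 2) h
  simp only [crossSum, squareSum, companion] at h2 ⊢
  linear_combination (1 - x ^ 2) ^ (2 * k + 2) * h2

lemma squareSum_and_crossSum_eq (n N : ℕ) (x : ℝ) (hx : 1 - x ^ 2 ≠ 0) (hN : N ≤ n) (k : ℕ)
    (hk : k + 1 ≤ N) :
    squareSum n x k = (∏ j ∈ Finset.range k, ((n : ℝ) ^ 2 - (j : ℝ) ^ 2)) * (1 - x ^ 2) ^ k *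
        sSum n k (1 - x ^ 2)⁻¹ N ∧
      crossSum n x k = x * (∏ j ∈ Finset.range k, ((n : ℝ) ^ 2 - (j : ℝ) ^ 2)) *
        (1 - x ^ 2) ^ k * sWeightedSum n k (1 - x ^ 2)⁻¹ N ∧
      squareSum n x (k + 1) = (∏ j ∈ Finset.range (k + 1), ((n : ℝ) ^ 2 - (j : ℝ) ^ 2)) *
        (1 - x ^ 2) ^ (k + 1) * sSum n (k + 1) (1 - x ^ 2)⁻¹ N := by
  induction k with
  | zero =>
    have h1 := sSum_of_le_one (n := n) (1 - x ^ 2)⁻¹ le_rfl hk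
    have h0 := sSum_of_le_one (n := n) (1 - x ^ 2)⁻¹ zero_le_one hk
    have hW := sWeightedSum_zero (n := n) (1 - x ^ 2)⁻¹ hk
    have hP := chebyshev_pell n x
    push_cast at h0 h1
    simp only [squareSum, crossSum, companion, zero_add, derivative_T_eval, Nat.cast_zero, h0, h1,
      hW, Function.iterate_zero, id, Finset.range_zero, Finset.prod_empty, Finset.prod_range_one]
    refine ⟨?_, ?_, ?_⟩
    · linear_combination hP
    · ring
    · linear_combination (n : ℝ) ^ 2 * (1 - x ^ 2) * hP
  | succ k ih =>
    obtain ⟨hE, hF, hE'⟩ := ih (by omega)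
    have hW := sWeightedSum_add_one n k (1 - x ^ 2)⁻¹ N
    have hS := sSum_add_two n k (1 - x ^ 2)⁻¹ N hk hN
    have hv : (1 - x ^ 2) * (1 - x ^ 2)⁻¹ = 1 := mul_inv_cancel₀ hx
    have hcast : (((k + 1 : ℕ) : ℝ) + 1) = (k : ℝ) + 2 := by push_cast; ring
    refine ⟨by exact_mod_cast hE', ?_, ?_⟩
    · rw [crossSum_succ, hE', hF, Finset.prod_range_succ]
      push_cast
      rw [hW]
      ring
    · rw [squareSum_add_two, hE', hF, hE, hcast, Finset.prod_range_succ _ (k + 1),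
        Finset.prod_range_succ]
      push_cast
      generalize (1 - x ^ 2)⁻¹ = v at *
      generalize (∏ j ∈ Finset.range k, ((n : ℝ) ^ 2 - (j : ℝ) ^ 2)) = C at *
      have hF' : sWeightedSum n k v N =
          (2 * k + 1) * sSum n (k + 1) v N - sWeightedSum n (k + 1) v N := by
        linear_combination hW
      rw [hF']
      linear_combination -(C * ((n : ℝ) ^ 2 - (k : ℝ) ^ 2) * (1 - x ^ 2) ^ (k + 2)) * hS -
        C * ((n : ℝ) ^ 2 - (k : ℝ) ^ 2) * (1 - x ^ 2) ^ (k + 1) * (2 * k + 1) *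
          (2 * sWeightedSum n (k + 1) v N - (2 * k + 1) * sSum n (k + 1) v N) * hv

lemma oddDoubleFac_mul_evenDoubleFac (k : ℕ) :
    oddDoubleFac k * evenDoubleFac k = ((2 * k).factorial : ℝ) := by
  induction k with
  | zero => simp [oddDoubleFac, evenDoubleFac]
  | succ k ih =>
    simp only [oddDoubleFac, evenDoubleFac] at ih ⊢
    rw [show 2 * (k + 1) = 2 * k + 1 + 1 by ring, Nat.factorial_succ, Nat.factorial_succ,
      Finset.prod_range_succ, Finset.prod_range_succ]
    push_cast
    linear_combination (2 * (k : ℝ) + 1) * (2 * k + 2) * ih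

lemma factorial_add_mul_eq (n k : ℕ) (hk : k < n) :
    ((n + k).factorial : ℝ) * (n - k) * n =
      (∏ j ∈ Finset.range (k + 1), ((n : ℝ) ^ 2 - (j : ℝ) ^ 2)) * ((n - k).factorial : ℝ) := by
  induction k with
  | zero =>
    simp
    ring
  | succ k ih =>
    have ih := ih (by omega)
    have hpos : (n : ℝ) - k ≠ 0 := sub_ne_zero.2 (by exact_mod_cast (by omega : n ≠ k))
    have hsub : (n - k).factorial = (n - k) * (n - (k + 1)).factorial := by
      rw [show n - (k + 1) = n - k - 1 by omega, Nat.mul_factorial_pred (by omega)]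
    rw [hsub, Nat.cast_mul, Nat.cast_sub (by omega)] at ih
    rw [Finset.prod_range_succ, ← add_assoc, Nat.factorial_succ]
    push_cast
    apply mul_left_cancel₀ hpos
    linear_combination ((n : ℝ) + k + 1) * (n - (k + 1)) * ih

lemma choose_mul_eq (n k : ℕ) (hk : k < n) :
    (Nat.choose (n + k) (n - k) : ℝ) * (n - k) * n * (oddDoubleFac k * evenDoubleFac k) =
      ∏ j ∈ Finset.range (k + 1), ((n : ℝ) ^ 2 - (j : ℝ) ^ 2) := by
  have h := Nat.choose_mul_factorial_mul_factorial (n := n + k) (k := n - k) (by omega)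
  rw [show n + k - (n - k) = 2 * k by omega] at h
  have h' : (Nat.choose (n + k) (n - k) : ℝ) * (n - k).factorial * (2 * k).factorial =
      (n + k).factorial := by exact_mod_cast h
  rw [oddDoubleFac_mul_evenDoubleFac]
  apply mul_right_cancel₀ (Nat.cast_ne_zero.2 (Nat.factorial_ne_zero (n - k)) : _ ≠ (0 : ℝ))
  rw [← factorial_add_mul_eq n k hk]
  linear_combination ((n : ℝ) - k) * n * h'

lemma one_sub_sq_ne_zero_of_root {n k : ℕ} (hk : k < n) {x : ℝ}
    (hx : (derivative^[k + 1] (Chebyshev.T ℝ (n : ℤ))).eval x = 0) : 1 - x ^ 2 ≠ 0 := by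
  intro hw
  have h := Chebyshev.one_sub_X_sq_mul_iterate_derivative_T_eval (R := ℝ) n k x
  have hW := wronskian_eq n x k
  have hl := (natCast_sq_sub_natCast_sq_pos hk).ne'
  push_cast at h
  have hp : (derivative^[k] (Chebyshev.T ℝ (n : ℤ))).eval x = 0 := by
    rw [hw, hx, zero_mul, mul_zero, zero_sub, eq_comm, neg_eq_zero] at h
    exact (mul_eq_zero.1 h).resolve_left hl
  rw [hp, hx, zero_mul, mul_zero, zero_mul, sub_zero, eq_comm, neg_mul, neg_eq_zero] at hW
  refine (mul_ne_zero (Nat.cast_ne_zero.2 (by omega)) (Finset.prod_ne_zero_iff.2 fun j hj => ?_)) hW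
  exact (natCast_sq_sub_natCast_sq_pos ((Finset.mem_range.1 hj).trans hk)).ne'

theorem stmt0 (n k : ℕ) (hk : 1 ≤ k) (hn : k + 1 < n) (ω : ℝ)
    (hωroot : (derivative^[k + 1] (Chebyshev.T ℝ (n : ℤ))).eval ω = 0)
    (hωmax : ∀ x : ℝ, (derivative^[k + 1] (Chebyshev.T ℝ (n : ℤ))).eval x = 0 → x ≤ ω) :
    (|(derivative^[k] (Chebyshev.T ℝ (n : ℤ))).eval ω| /
        (derivative^[k] (Chebyshev.T ℝ (n : ℤ))).eval 1) ^ 2 =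
      (oddDoubleFac k / evenDoubleFac k) * ((n : ℝ) / ((n : ℝ) - (k : ℝ))) *
        ((Nat.choose (n + k) (n - k) : ℝ))⁻¹ * ((1 - ω ^ 2) ^ k * S n (k + 1) ω)⁻¹ := by
  have hw := one_sub_sq_ne_zero_of_root (by omega : k < n) hωroot
  have hE := (squareSum_and_crossSum_eq n (k + 1) ω hw (by omega) k le_rfl).2.2
  have hW := wronskian_eq n ω k
  have hone := Chebyshev.iterate_derivative_T_eval_one (R := ℝ) n k
  have hchoose := choose_mul_eq n k (by omega)
  have hC : ∏ j ∈ Finset.range k, ((n : ℝ) ^ 2 - (j : ℝ) ^ 2) ≠ 0 :=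
    Finset.prod_ne_zero_iff.2 fun j hj =>
      (natCast_sq_sub_natCast_sq_pos ((Finset.mem_range.1 hj).trans (by omega))).ne'
  have hC' : ∏ j ∈ Finset.range (k + 1), ((n : ℝ) ^ 2 - (j : ℝ) ^ 2) ≠ 0 :=
    Finset.prod_ne_zero_iff.2 fun j hj =>
      (natCast_sq_sub_natCast_sq_pos ((Finset.mem_range.1 hj).trans (by omega))).ne'
  have hn0 : (n : ℝ) ≠ 0 := Nat.cast_ne_zero.2 (by omega)
  have hnk : (n : ℝ) - k ≠ 0 := sub_ne_zero.2 (by exact_mod_cast (by omega : n ≠ k))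
  have ho := (oddDoubleFac_pos k).ne'
  have he := (evenDoubleFac_pos k).ne'
  have hb : (Nat.choose (n + k) (n - k) : ℝ) ≠ 0 :=
    Nat.cast_ne_zero.2 (Nat.choose_pos (by omega)).ne'
  rw [sSum_eq_S, squareSum, hωroot] at hE
  rw [hωroot] at hW
  push_cast at hone
  change oddDoubleFac k * _ = _ at hone
  rw [div_pow, sq_abs]
  generalize ∏ j ∈ Finset.range k, ((n : ℝ) ^ 2 - (j : ℝ) ^ 2) = C at *
  generalize ∏ j ∈ Finset.range (k + 1), ((n : ℝ) ^ 2 - (j : ℝ) ^ 2) = C' at *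
  generalize (derivative^[k] (Chebyshev.T ℝ (n : ℤ))).eval ω = p at *
  generalize (derivative^[k] (Chebyshev.T ℝ (n : ℤ))).eval 1 = p₁ at *
  generalize companion n ω (k + 1) = q at *
  have hq : q ^ 2 = C' * ((1 - ω ^ 2) ^ k * S n (k + 1) ω) := by
    apply mul_left_cancel₀ hw
    linear_combination hE
  have hpq : p * q = -n * C := by linear_combination hW
  have hprod : p ^ 2 * (C' * ((1 - ω ^ 2) ^ k * S n (k + 1) ω)) = (n * C) ^ 2 := by
    rw [← hq]
    linear_combination (p * q - n * C) * hpq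
  generalize (1 - ω ^ 2) ^ k * S n (k + 1) ω = D at *
  have hD : D ≠ 0 := by
    rintro rfl
    rw [mul_zero, mul_zero, eq_comm] at hprod
    exact pow_ne_zero 2 (mul_ne_zero hn0 hC) hprod
  have hp₁ : p₁ ≠ 0 := by
    rintro rfl
    exact hC (by rw [← hone, mul_zero])
  field_simp
  rw [← hone, ← hchoose] at hprod
  apply mul_left_cancel₀ (mul_ne_zero hn0 ho)
  linear_combination hprod
end

section
/- Let n and k be integers with k ≥ 1 and n > k+1. Then τ_{n,k} ≤ (2k-1)!! / ((n+k-1)(n+k-3)⋯(n-k+1)) · (n/(k+2))^k, where (n+k-1)(n+k-3)⋯(n-k+1) = ∏_{j=1}^{k} (n+k+1-2j). -/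
open Polynomial Finset

/-- A real polynomial with only real roots satisfies `p p'' ≤ p' ^ 2` pointwise. -/
theorem Polynomial.Splits.eval_mul_eval_derivative_derivative_le {p : ℝ[X]} (hp : p.Splits)
    (x : ℝ) : p.eval x * (derivative (derivative p)).eval x ≤ (derivative p).eval x ^ 2 := by
  obtain ⟨m, hm⟩ := splits_iff_exists_multiset.mp hp
  rw [hm]
  clear hm
  induction m using Multiset.induction with
  | empty => simp
  | cons a m ih =>
    set r := C p.leadingCoeff * (m.map (X - C ·)).prod with hr
    have hcons : C p.leadingCoeff * ((a ::ₘ m).map (X - C ·)).prod = (X - C a) * r := by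
      rw [hr, Multiset.map_cons, Multiset.prod_cons]
      ring
    rw [hcons]
    simp only [derivative_mul, derivative_sub, derivative_X, derivative_C, derivative_add,
      eval_mul, eval_add, eval_sub, eval_X, eval_C, sub_zero, one_mul]
    nlinarith [mul_le_mul_of_nonneg_left ih (sq_nonneg (x - a)), sq_nonneg (r.eval x)]

/-- The derivative of a real polynomial with only real roots has only real roots. -/
theorem Polynomial.Splits.derivative_real {p : ℝ[X]} (hp : p.Splits) :
    (derivative p).Splits := by
  rcases Nat.eq_zero_or_pos p.natDegree with h0 | hpos
  · rw [derivative_of_natDegree_zero h0]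
    exact Splits.zero
  · have hrolle := card_roots_le_derivative p
    have hle := card_roots' (derivative p)
    have hdeg := natDegree_derivative_lt hpos.ne'
    rw [splits_iff_card_roots] at hp ⊢
    omega

/-- At a root of a real polynomial with only real roots, `4 p' p''' ≤ 3 p'' ^ 2`. -/
theorem Polynomial.Splits.four_mul_eval_derivative_mul_le {p : ℝ[X]} (hp : p.Splits)
    {x : ℝ} (hx : p.eval x = 0) :
    4 * ((derivative p).eval x * (derivative^[3] p).eval x) ≤
      3 * (derivative^[2] p).eval x ^ 2 := by
  obtain ⟨q, rfl⟩ := dvd_iff_isRoot.mpr hx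
  have hq := (splits_X_sub_C_mul_iff.mp hp).eval_mul_eval_derivative_derivative_le x
  simp only [Function.iterate_succ, Function.iterate_zero, Function.comp_apply, id_eq,
    derivative_mul, derivative_sub, derivative_X, derivative_C, derivative_add,
    eval_mul, eval_add, eval_sub, eval_X, eval_C, sub_zero, one_mul, zero_mul, sub_self]
  nlinarith

namespace Polynomial.Chebyshev

theorem splits_iterate_derivative_T_real (n j : ℕ) : (derivative^[j] (T ℝ (n : ℤ))).Splits := by
  induction j with
  | zero =>
    rw [Function.iterate_zero, id_eq, splits_iff_card_roots, roots_T_real, Finset.card_val,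
      Finset.card_image_of_injOn
        ((Finset.range n).nodup_map_iff_injOn.mp (roots_T_real_nodup n)),
      Finset.card_range, natDegree_T, Int.natAbs_natCast]
  | succ j ih =>
    rw [Function.iterate_succ_apply']
    exact ih.derivative_real

theorem eval_iterate_derivative_T_real_self_ne_zero (n : ℕ) (x : ℝ) :
    (derivative^[n] (T ℝ (n : ℤ))).eval x ≠ 0 := by
  have hdeg : (T ℝ (n : ℤ)).natDegree = n := by simp
  have hconst : (derivative^[n] (T ℝ (n : ℤ))).natDegree = 0 := by
    have := natDegree_iterate_derivative (T ℝ (n : ℤ)) n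
    omega
  rw [eq_C_of_natDegree_eq_zero hconst, eval_C, coeff_iterate_derivative, zero_add,
    Nat.descFactorial_self, nsmul_eq_mul]
  refine mul_ne_zero (by positivity) ?_
  nth_rewrite 2 [← hdeg]
  rw [coeff_natDegree, leadingCoeff_ne_zero]
  exact T_ne_zero ℝ n

/-- The derivatives of `T n` of order at most `n` have only simple roots. -/
theorem eval_iterate_derivative_succ_T_real_ne_zero {n j : ℕ} (hj : j ≤ n) {x : ℝ}
    (hx : (derivative^[j] (T ℝ (n : ℤ))).eval x = 0) :
    (derivative^[j + 1] (T ℝ (n : ℤ))).eval x ≠ 0 := by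
  intro hx'
  have hall : ∀ i, (derivative^[j + i] (T ℝ (n : ℤ))).eval x = 0 ∧
      (derivative^[j + i + 1] (T ℝ (n : ℤ))).eval x = 0 := by
    intro i
    induction i with
    | zero => exact ⟨hx, hx'⟩
    | succ i ih =>
      refine ⟨ih.2, ?_⟩
      have h₁ := one_sub_X_sq_mul_iterate_derivative_T_eval (n : ℤ) (j + i) x
      have h₂ := one_sub_X_sq_mul_iterate_derivative_T_eval (n : ℤ) (j + i + 1) x
      rw [ih.1, ih.2] at h₁
      rw [ih.2] at h₂
      by_cases hs : 1 - x ^ 2 = 0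
      · have hx0 : x ≠ 0 := by
          rintro rfl
          norm_num at hs
        rw [hs, zero_mul, mul_zero, sub_zero] at h₂
        have hc : (2 * ((j + i + 1 : ℕ) : ℝ) + 1) * x ≠ 0 := mul_ne_zero (by positivity) hx0
        exact (mul_eq_zero.mp h₂.symm).resolve_left hc
      · rw [mul_zero, mul_zero, sub_zero] at h₁
        exact (mul_eq_zero.mp h₁).resolve_left hs
  have h := (hall (n - j)).1
  rw [Nat.add_sub_cancel' hj] at h
  exact eval_iterate_derivative_T_real_self_ne_zero n x h

/-- Every root `x` of the `j`-th derivative of `T n` satisfies `n² (1 - x²) ≥ (j + 1)²`. -/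
theorem sq_le_sq_mul_one_sub_sq_of_root {n j : ℕ} (hj : 1 ≤ j) (hjn : j < n) {x : ℝ}
    (hx : (derivative^[j] (T ℝ (n : ℤ))).eval x = 0) :
    ((j : ℝ) + 1) ^ 2 ≤ (n : ℝ) ^ 2 * (1 - x ^ 2) := by
  have hne := eval_iterate_derivative_succ_T_real_ne_zero hjn.le hx
  have hlag := (splits_iterate_derivative_T_real n j).four_mul_eval_derivative_mul_le hx
  have h₁ := one_sub_X_sq_mul_iterate_derivative_T_eval (n : ℤ) j x
  have h₂ := one_sub_X_sq_mul_iterate_derivative_T_eval (n : ℤ) (j + 1) x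
  rw [← Function.iterate_succ_apply' derivative, ← Function.iterate_add_apply,
    ← Function.iterate_add_apply, add_comm 3, add_comm 2] at hlag
  rw [hx] at h₁
  simp only [Nat.succ_eq_add_one, add_assoc, Nat.reduceAdd] at hlag h₁ h₂ hne
  push_cast at h₁ h₂
  set a := (derivative^[j + 1] (T ℝ (n : ℤ))).eval x
  set b := (derivative^[j + 2] (T ℝ (n : ℤ))).eval x
  set c := (derivative^[j + 3] (T ℝ (n : ℤ))).eval x
  have hsb : ((1 - x ^ 2) * b) ^ 2 = ((2 * j + 1) * x * a) ^ 2 := by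
    rw [h₁]
    ring
  have hsc : (1 - x ^ 2) ^ 2 * c = (2 * (j + 1) + 1) * x * ((2 * j + 1) * x * a) -
      ((n : ℝ) ^ 2 - (j + 1) ^ 2) * (1 - x ^ 2) * a := by
    linear_combination (1 - x ^ 2) * h₂ + (2 * ((j : ℝ) + 1) + 1) * x * h₁
  have hmul : 4 * (a * ((1 - x ^ 2) ^ 2 * c)) ≤ 3 * ((1 - x ^ 2) * b) ^ 2 := by
    nlinarith [mul_le_mul_of_nonneg_left hlag (sq_nonneg (1 - x ^ 2))]
  rw [hsb, hsc] at hmul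
  have ha : 0 < a ^ 2 := by positivity
  have hkey : x ^ 2 * ((2 * j + 1) * (2 * j + 9)) ≤
      4 * ((n : ℝ) ^ 2 - (j + 1) ^ 2) * (1 - x ^ 2) := by
    refine le_of_mul_le_mul_left ?_ ha
    linarith
  have hj1 : (1 : ℝ) ≤ j := by exact_mod_cast hj
  nlinarith [mul_nonneg (sq_nonneg x) (by linarith : (0 : ℝ) ≤ 12 * j + 5)]

/-- The Sonin-type energy of the `(k + 1)`-st derivative of `T n`. -/
noncomputable def energy (n k : ℕ) (x : ℝ) : ℝ :=
  (1 - x ^ 2) ^ k *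
    ((((k : ℝ) + 1) * x * (derivative^[k + 1] (T ℝ (n : ℤ))).eval x -
        (1 - x ^ 2) * (derivative^[k + 2] (T ℝ (n : ℤ))).eval x) ^ 2 +
      ((n : ℝ) ^ 2 * (1 - x ^ 2) - k * (k + 1)) *
        (derivative^[k + 1] (T ℝ (n : ℤ))).eval x ^ 2)

theorem hasDerivAt_energy (n k : ℕ) (x : ℝ) :
    HasDerivAt (energy n (k + 1))
      (-2 * (k + 1) * (k + 2) * x * (1 - x ^ 2) ^ k *
        (derivative^[k + 2] (T ℝ (n : ℤ))).eval x ^ 2) x := by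
  have hode := one_sub_X_sq_mul_iterate_derivative_T_eval (n : ℤ) (k + 2) x
  have hu : HasDerivAt (fun x : ℝ => 1 - x ^ 2) (-(2 * x)) x := by
    simpa using (hasDerivAt_pow 2 x).const_sub 1
  have hy := (derivative^[k + 2] (T ℝ (n : ℤ))).hasDerivAt x
  have hy' := (derivative^[k + 3] (T ℝ (n : ℤ))).hasDerivAt x
  rw [← Function.iterate_succ_apply' derivative] at hy hy'
  have hz := (((hasDerivAt_id x).const_mul (((k + 1 : ℕ) : ℝ) + 1)).mul hy).sub (hu.mul hy')
  have hw := ((hu.const_mul ((n : ℝ) ^ 2)).sub_const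
    (((k + 1 : ℕ) : ℝ) * (((k + 1 : ℕ) : ℝ) + 1))).mul (hy.pow 2)
  have h := (hu.pow (k + 1)).mul ((hz.pow 2).add hw)
  refine (h.congr_deriv ?_).congr_of_eventuallyEq (Filter.Eventually.of_forall fun y => ?_)
  · simp only [Nat.succ_eq_add_one, add_assoc, Nat.reduceAdd, Pi.mul_apply, Pi.sub_apply,
      Pi.pow_apply, Pi.add_apply, id_eq, Nat.add_sub_cancel, Nat.reduceSub] at hode ⊢
    push_cast at hode ⊢
    set y := (derivative^[k + 2] (T ℝ (n : ℤ))).eval x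
    set y' := (derivative^[k + 3] (T ℝ (n : ℤ))).eval x
    linear_combination -2 * (1 - x ^ 2) ^ (k + 1) *
      (((k : ℝ) + (1 + 1)) * x * y - (1 - x ^ 2) * y') * hode
  · simp [energy]

theorem energy_le_energy_zero (n k : ℕ) {x : ℝ} (hx : x ^ 2 ≤ 1) :
    energy n (k + 1) x ≤ energy n (k + 1) 0 := by
  have hcont : Continuous (energy n (k + 1)) :=
    continuous_iff_continuousAt.mpr fun y => (hasDerivAt_energy n k y).continuousAt
  have hx1 := abs_le.mp ((sq_le_one_iff_abs_le_one x).mp hx)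
  rcases le_total 0 x with h0 | h0
  · refine antitoneOn_of_hasDerivWithinAt_nonpos (convex_Icc 0 1) hcont.continuousOn
      (fun y _ => (hasDerivAt_energy n k y).hasDerivWithinAt) (fun y hy => ?_)
      (Set.left_mem_Icc.mpr zero_le_one) ⟨h0, hx1.2⟩ h0
    rw [interior_Icc] at hy
    have hy0 := hy.1.le
    have hu : 0 ≤ 1 - y ^ 2 := by nlinarith [hy.1, hy.2]
    have : 0 ≤ 2 * ((k : ℝ) + 1) * (k + 2) * y * (1 - y ^ 2) ^ k *
        (derivative^[k + 2] (T ℝ (n : ℤ))).eval y ^ 2 := by positivity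
    linarith
  · refine monotoneOn_of_hasDerivWithinAt_nonneg (convex_Icc (-1) 0) hcont.continuousOn
      (fun y _ => (hasDerivAt_energy n k y).hasDerivWithinAt) (fun y hy => ?_)
      ⟨hx1.1, h0⟩ (Set.right_mem_Icc.mpr (by norm_num)) h0
    rw [interior_Icc] at hy
    have hy0 : 0 ≤ -y := by linarith [hy.2]
    have hu : 0 ≤ 1 - y ^ 2 := by nlinarith [hy.1, hy.2]
    have : 0 ≤ 2 * ((k : ℝ) + 1) * (k + 2) * (-y) * (1 - y ^ 2) ^ k *
        (derivative^[k + 2] (T ℝ (n : ℤ))).eval y ^ 2 := by positivity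
    linarith

/-- The absolute value at `0` of the `j`-th derivative of `T n` when `n + j` is even, continued
to all `j` by the recurrence in `j`. -/
noncomputable def centralValue (n : ℝ) : ℕ → ℝ
  | 0 => 1
  | 1 => n
  | j + 2 => (n ^ 2 - (j : ℝ) ^ 2) * centralValue n j

theorem sq_eval_zero_iterate_derivative_T (n : ℕ) : ∀ j : ℕ,
    (derivative^[j] (T ℝ (n : ℤ))).eval 0 ^ 2 =
      if Even (n + j) then centralValue n j ^ 2 else 0
  | 0 => by
    rw [Function.iterate_zero, id_eq, T_eval_zero, add_zero]
    by_cases h : Even n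
    · rcases Int.even_or_odd ((n : ℤ) / 2) with h' | h' <;>
        simp [h, centralValue, Int.negOnePow_even _, Int.negOnePow_odd _, h']
    · simp [h]
  | 1 => by
    rw [Function.iterate_one, T_derivative_eq_U, eval_mul, U_eval_zero]
    by_cases h : Even n
    · simp [h, Nat.even_add_one]
    · rcases Int.even_or_odd (((n : ℤ) - 1) / 2) with h' | h' <;>
        simp [h, Nat.even_add_one, centralValue, Int.negOnePow_even _,
          Int.negOnePow_odd _, h']
  | j + 2 => by
    rw [iterate_derivative_T_eval_zero_recurrence, mul_pow, sq_eval_zero_iterate_derivative_T n j,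
      centralValue]
    have : Even (n + (j + 2)) ↔ Even (n + j) := by
      rw [← add_assoc, Nat.even_add]
      simp
    simp only [this]
    split_ifs
    · push_cast
      ring
    · simp

theorem mul_centralValue_sq_le (n : ℝ) : ∀ j : ℕ,
    (n ^ 2 - (j : ℝ) * (j - 1)) * centralValue n j ^ 2 ≤ centralValue n (j + 1) ^ 2
  | 0 => by simp [centralValue]
  | 1 => by
    simp only [centralValue]
    norm_num
    apply le_of_eq
    ring
  | j + 2 => by
    have ih := mul_centralValue_sq_le n j
    have h := mul_le_mul_of_nonneg_left ih (sq_nonneg (n ^ 2 - ((j : ℝ) + 1) ^ 2))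
    have hpos : 0 ≤ ((2 * j + 1) * n ^ 2 + j * (j + 1) * (2 * j + 1)) * centralValue n j ^ 2 := by
      positivity
    simp only [centralValue]
    push_cast
    linarith

theorem centralValue_succ (n : ℝ) : ∀ k : ℕ,
    centralValue n (k + 1) = n * ∏ j ∈ Finset.Icc 1 k, (n + (k : ℝ) + 1 - 2 * (j : ℝ))
  | 0 => by simp [centralValue]
  | 1 => by
    simp [centralValue]
    ring
  | k + 2 => by
    have hIcc (m : ℕ) (g : ℕ → ℝ) :
        ∏ j ∈ Finset.Icc 1 m, g j = ∏ j ∈ Finset.range m, g (j + 1) := by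
      induction m with
      | zero => simp
      | succ m ih => rw [Finset.prod_Icc_succ_top (by omega), ih, Finset.prod_range_succ]
    rw [centralValue, centralValue_succ n k, hIcc, hIcc, Finset.prod_range_succ,
      Finset.prod_range_succ']
    have hshift : ∏ j ∈ Finset.range k, (n + ((k + 2 : ℕ) : ℝ) + 1 - 2 * ((j + 1 + 1 : ℕ) : ℝ)) =
        ∏ j ∈ Finset.range k, (n + (k : ℝ) + 1 - 2 * ((j + 1 : ℕ) : ℝ)) :=
      Finset.prod_congr rfl fun j _ => by
        push_cast
        ring
    rw [hshift]
    push_cast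
    ring

theorem centralValue_mul_centralValue_succ (n : ℝ) (k : ℕ) :
    centralValue n k * centralValue n (k + 1) =
      n * ∏ j ∈ Finset.range k, (n ^ 2 - (j : ℝ) ^ 2) := by
  induction k with
  | zero => simp [centralValue]
  | succ k ih =>
    rw [Finset.prod_range_succ, ← mul_assoc, ← ih, centralValue]
    ring

/-- At a critical point `x ∈ [-1, 1]` of the `k`-th derivative `f` of `T n`, the quantity
`(1 - x²) ^ k * f x ^ 2` is at most the square of the central value. -/
theorem one_sub_sq_pow_mul_sq_le {n k : ℕ} (hk : 1 ≤ k) (hkn : k < n) {x : ℝ}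
    (hx1 : x ^ 2 ≤ 1) (hx : (derivative^[k + 1] (T ℝ (n : ℤ))).eval x = 0) :
    (1 - x ^ 2) ^ k * (derivative^[k] (T ℝ (n : ℤ))).eval x ^ 2 ≤ centralValue n k ^ 2 := by
  obtain ⟨k, rfl⟩ := Nat.exists_eq_add_of_le' hk
  have hE := energy_le_energy_zero n k hx1
  have hode := one_sub_X_sq_mul_iterate_derivative_T_eval (n : ℤ) (k + 1) x
  have hnk : ((k + 1 : ℕ) : ℝ) < n := by exact_mod_cast hkn
  have hpos : 0 < ((n : ℝ) ^ 2 - ((k + 1 : ℕ) : ℝ) ^ 2) ^ 2 := by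
    have : 0 < (n : ℝ) ^ 2 - ((k + 1 : ℕ) : ℝ) ^ 2 := by
      nlinarith [(k + 1).cast_nonneg (α := ℝ)]
    positivity
  have hzero : energy n (k + 1) 0 ≤ centralValue n (k + 1 + 2) ^ 2 := by
    have h₁ := sq_eval_zero_iterate_derivative_T n (k + 1 + 1)
    have h₂ := sq_eval_zero_iterate_derivative_T n (k + 1 + 2)
    have hlow := mul_centralValue_sq_le n (k + 1 + 1)
    have heq : energy n (k + 1) 0 = (derivative^[k + 1 + 2] (T ℝ (n : ℤ))).eval 0 ^ 2 +
        ((n : ℝ) ^ 2 - ((k + 1 : ℕ) : ℝ) * (((k + 1 : ℕ) : ℝ) + 1)) *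
          (derivative^[k + 1 + 1] (T ℝ (n : ℤ))).eval 0 ^ 2 := by
      simp [energy]
    rw [heq, h₁, h₂]
    by_cases hev : Even (n + (k + 1 + 1))
    · have : ¬ Even (n + (k + 1 + 2)) := by grind
      rw [if_pos hev, if_neg this]
      push_cast at hlow ⊢
      linarith
    · rw [if_neg hev, mul_zero, add_zero]
      split_ifs
      · exact le_rfl
      · positivity
  have hleft : energy n (k + 1) x = ((n : ℝ) ^ 2 - ((k + 1 : ℕ) : ℝ) ^ 2) ^ 2 *
      ((1 - x ^ 2) ^ (k + 1) * (derivative^[k + 1] (T ℝ (n : ℤ))).eval x ^ 2) := by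
    rw [energy, hode, hx]
    push_cast
    ring
  rw [hleft] at hE
  rw [centralValue, mul_pow] at hzero
  exact le_of_mul_le_mul_left (hE.trans hzero) hpos

end Polynomial.Chebyshev

theorem stmt2 (n k : ℕ) (hk : 1 ≤ k) (hn : k + 1 < n) (ω : ℝ)
    (hωroot : (derivative^[k + 1] (Chebyshev.T ℝ (n : ℤ))).eval ω = 0)
    (hωmax : ∀ x : ℝ, (derivative^[k + 1] (Chebyshev.T ℝ (n : ℤ))).eval x = 0 → x ≤ ω) :
    |(derivative^[k] (Chebyshev.T ℝ (n : ℤ))).eval ω| /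
        (derivative^[k] (Chebyshev.T ℝ (n : ℤ))).eval 1 ≤
      oddDoubleFac k / (∏ j ∈ Finset.Icc 1 k, ((n : ℝ) + (k : ℝ) + 1 - 2 * (j : ℝ))) *
        ((n : ℝ) / ((k : ℝ) + 2)) ^ k := by
  have hn0 : (0 : ℝ) < n := by
    have : 0 < n := by omega
    exact_mod_cast this
  have hkn : (k : ℝ) + 1 < n := by exact_mod_cast hn
  have hroot := Chebyshev.sq_le_sq_mul_one_sub_sq_of_root (by omega) hn hωroot
  have hroot' : (((k : ℝ) + 2) / n) ^ 2 ≤ 1 - ω ^ 2 := by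
    rw [div_pow, div_le_iff₀ (by positivity)]
    push_cast at hroot
    linarith
  have hω1 : ω ^ 2 ≤ 1 := by
    have : 0 ≤ (((k : ℝ) + 2) / n) ^ 2 := by positivity
    linarith
  have hmain := Chebyshev.one_sub_sq_pow_mul_sq_le hk (by omega) hω1 hωroot
  have hone := Chebyshev.iterate_derivative_T_eval_one (R := ℝ) (n : ℤ) k
  have hprod := Chebyshev.centralValue_mul_centralValue_succ n k
  rw [Chebyshev.centralValue_succ] at hprod
  have hB : 0 < ∏ j ∈ Finset.Icc 1 k, ((n : ℝ) + (k : ℝ) + 1 - 2 * (j : ℝ)) := by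
    refine Finset.prod_pos fun j hj => ?_
    have : (j : ℝ) ≤ k := by exact_mod_cast (Finset.mem_Icc.mp hj).2
    linarith
  have hP : 0 < ∏ j ∈ Finset.range k, ((n : ℝ) ^ 2 - (j : ℝ) ^ 2) := by
    refine Finset.prod_pos fun j hj => ?_
    have : (j : ℝ) < k := by exact_mod_cast Finset.mem_range.mp hj
    nlinarith [j.cast_nonneg (α := ℝ)]
  have hO : 0 < oddDoubleFac k := Finset.prod_pos fun j _ => by positivity
  have hone' : oddDoubleFac k * (derivative^[k] (Chebyshev.T ℝ (n : ℤ))).eval 1 =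
      ∏ j ∈ Finset.range k, ((n : ℝ) ^ 2 - (j : ℝ) ^ 2) := by
    rw [oddDoubleFac]
    push_cast at hone
    exact hone
  set B := ∏ j ∈ Finset.Icc 1 k, ((n : ℝ) + (k : ℝ) + 1 - 2 * (j : ℝ))
  set P := ∏ j ∈ Finset.range k, ((n : ℝ) ^ 2 - (j : ℝ) ^ 2)
  set F := (derivative^[k] (Chebyshev.T ℝ (n : ℤ))).eval 1
  set f := (derivative^[k] (Chebyshev.T ℝ (n : ℤ))).eval ω
  set A := Chebyshev.centralValue n k
  have hF : 0 < F := pos_of_mul_pos_right (hone' ▸ hP) hO.le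
  have hAB : A * B = P := mul_left_cancel₀ hn0.ne' (by linarith)
  have hA : 0 < A := pos_of_mul_pos_left (hAB ▸ hP) hB.le
  have hf : (((k : ℝ) + 2) / n) ^ k * |f| ≤ A := by
    refine abs_le_of_sq_le_sq' ?_ hA.le |>.2
    rw [mul_pow, sq_abs, ← pow_mul, mul_comm k 2, pow_mul]
    exact (mul_le_mul_of_nonneg_right (pow_le_pow_left₀ (sq_nonneg _) hroot' k)
      (sq_nonneg f)).trans hmain
  have hc : (((k : ℝ) + 2) / n) ^ k * ((n : ℝ) / ((k : ℝ) + 2)) ^ k = 1 := by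
    rw [← mul_pow, div_mul_div_cancel₀ hn0.ne', div_self (by positivity), one_pow]
  have hfA : |f| ≤ A * ((n : ℝ) / ((k : ℝ) + 2)) ^ k := by
    have := mul_le_mul_of_nonneg_right hf
      (by positivity : (0 : ℝ) ≤ ((n : ℝ) / ((k : ℝ) + 2)) ^ k)
    linear_combination this - |f| * hc
  have hAF : A = oddDoubleFac k / B * F := by
    field_simp
    linarith
  rw [div_le_iff₀ hF]
  calc |f| ≤ A * ((n : ℝ) / ((k : ℝ) + 2)) ^ k := hfA
    _ = _ := by rw [hAF]; ring
end

section
/- Let n and k be integers with k ≥ 1 and n > k+1. Then τ_{n,k} / τ_{n+1,k} ≤ ((n+k)(n+k-2)⋯(n-k+2)) / ((n+k-1)(n+k-3)⋯(n-k+1)), where the numerator is ∏_{j=1}^{k} (n+k+2-2j) and the denominator is ∏_{j=1}^{k} (n+k+1-2j). -/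
open Polynomial Finset

/-- Iterated form of `U_m = X U_{m-1} + T_m`, written in terms of derivatives of `T`. -/
lemma mul_iterate_derivative_T_add_one_eval (m : ℤ) (k : ℕ) (x : ℝ) :
    (m : ℝ) * (derivative^[k + 1] (Chebyshev.T ℝ (m + 1))).eval x =
      (m + 1) * (x * (derivative^[k + 1] (Chebyshev.T ℝ m)).eval x +
        (m + k) * (derivative^[k] (Chebyshev.T ℝ m)).eval x) := by
  have hpoly : (m : ℝ[X]) * derivative (Chebyshev.T ℝ (m + 1)) =
      ((m + 1 : ℤ) : ℝ[X]) * (derivative (Chebyshev.T ℝ m) * X + (m : ℝ[X]) * Chebyshev.T ℝ m) := by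
    have hU := Chebyshev.U_eq_X_mul_U_add_T ℝ (m - 1)
    rw [sub_add_cancel] at hU
    rw [Chebyshev.T_derivative_eq_U, Chebyshev.T_derivative_eq_U, add_sub_cancel_right, hU]
    ring
  have h := congr_arg (fun p : ℝ[X] => (derivative^[k] p).eval x) hpoly
  simp only [iterate_derivative_intCast_mul, iterate_map_add,
    iterate_derivative_derivative_mul_X, ← Function.iterate_succ_apply, eval_mul, eval_add,
    eval_intCast, eval_X, nsmul_eq_mul, eval_natCast] at h
  push_cast at h
  linear_combination h

/-- Iterated form of `U_{m-1} = X U_m - T_{m+1}`, written in terms of derivatives of `T`. -/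
lemma add_one_mul_iterate_derivative_T_eval (m : ℤ) (k : ℕ) (x : ℝ) :
    ((m : ℝ) + 1) * (derivative^[k + 1] (Chebyshev.T ℝ m)).eval x =
      m * (x * (derivative^[k + 1] (Chebyshev.T ℝ (m + 1))).eval x -
        (m + 1 - k) * (derivative^[k] (Chebyshev.T ℝ (m + 1))).eval x) := by
  have hpoly : ((m + 1 : ℤ) : ℝ[X]) * derivative (Chebyshev.T ℝ m) =
      (m : ℝ[X]) * (derivative (Chebyshev.T ℝ (m + 1)) * X -
        ((m + 1 : ℤ) : ℝ[X]) * Chebyshev.T ℝ (m + 1)) := by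
    have hT := Chebyshev.T_eq_X_mul_U_sub_U ℝ (m - 1)
    rw [sub_add_cancel, show m - 1 + 2 = m + 1 by ring] at hT
    rw [Chebyshev.T_derivative_eq_U, Chebyshev.T_derivative_eq_U, add_sub_cancel_right, hT]
    ring
  have h := congr_arg (fun p : ℝ[X] => (derivative^[k] p).eval x) hpoly
  simp only [iterate_derivative_intCast_mul, iterate_derivative_sub,
    iterate_derivative_derivative_mul_X, ← Function.iterate_succ_apply, eval_mul, eval_add,
    eval_sub, eval_intCast, eval_X, nsmul_eq_mul, eval_natCast] at h
  push_cast at h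
  linear_combination h

lemma iterate_derivative_T_eval_pos (n k : ℕ) (hkn : k ≤ n) {x : ℝ} (hx : 1 ≤ x) :
    0 < (derivative^[k] (Chebyshev.T ℝ (n : ℤ))).eval x := by
  induction n generalizing k with
  | zero =>
    obtain rfl : k = 0 := by omega
    simp
  | succ n ih =>
    rcases k with _ | k
    · exact zero_lt_one.trans_le (Chebyshev.one_le_eval_T_real _ hx)
    rcases Nat.eq_zero_or_pos n with rfl | hn
    · obtain rfl : k = 0 := by omega
      simp
    have hrec := mul_iterate_derivative_T_add_one_eval (n : ℤ) k x
    have hk := ih k (by omega)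
    have hk' : 0 ≤ (derivative^[k + 1] (Chebyshev.T ℝ (n : ℤ))).eval x := by
      rcases Nat.lt_or_ge k n with h | h
      · exact (ih (k + 1) h).le
      · rw [iterate_derivative_eq_zero (by simpa using Nat.lt_succ_of_le h)]
        simp
    have hn' : (0 : ℝ) < n := by exact_mod_cast hn
    push_cast at hrec ⊢
    refine pos_of_mul_pos_right (a := (n : ℝ)) ?_ hn'.le
    rw [hrec]
    positivity

lemma iterate_derivative_comp_neg_X_eval (p : ℝ[X]) (k : ℕ) (x : ℝ) :
    (derivative^[k] (p.comp (-X))).eval x = (-1) ^ k * (derivative^[k] p).eval (-x) := by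
  induction k generalizing p with
  | zero => simp
  | succ k ih =>
    rw [Function.iterate_succ_apply, Function.iterate_succ_apply, derivative_comp]
    simp only [derivative_neg, derivative_X, neg_mul, one_mul, iterate_derivative_neg, eval_neg, ih]
    ring

lemma iterate_derivative_T_eval_neg_eq_zero {m : ℤ} {k : ℕ} {x : ℝ}
    (hx : (derivative^[k] (Chebyshev.T ℝ m)).eval x = 0) :
    (derivative^[k] (Chebyshev.T ℝ m)).eval (-x) = 0 := by
  have hcomp : (Chebyshev.T ℝ m).comp (-X) = ((m.negOnePow : ℤ) : ℝ[X]) * Chebyshev.T ℝ m := by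
    refine Polynomial.funext fun y => ?_
    simp [Chebyshev.T_eval_neg]
  have h := iterate_derivative_comp_neg_X_eval (Chebyshev.T ℝ m) k x
  rw [hcomp, iterate_derivative_intCast_mul, eval_mul, hx, mul_zero] at h
  exact (mul_eq_zero.mp h.symm).resolve_left (by simp)

/-- Sonin's function of `T_m^{(k)}` is nondecreasing on `[0, ∞)`. -/
lemma monotoneOn_sonin_iterate_derivative_T (m : ℤ) (k : ℕ) (hm : (0 : ℝ) < (m : ℝ) ^ 2 - k ^ 2) :
    MonotoneOn (fun x : ℝ => (derivative^[k] (Chebyshev.T ℝ m)).eval x ^ 2 +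
      (1 - x ^ 2) * (derivative^[k + 1] (Chebyshev.T ℝ m)).eval x ^ 2 / ((m : ℝ) ^ 2 - k ^ 2))
      (Set.Ici 0) := by
  have hd (j : ℕ) (x : ℝ) : HasDerivAt (fun y => (derivative^[j] (Chebyshev.T ℝ m)).eval y)
      ((derivative^[j + 1] (Chebyshev.T ℝ m)).eval x) x := by
    rw [Function.iterate_succ_apply']
    exact Polynomial.hasDerivAt _ x
  have hderiv (x : ℝ) := ((hd k x).pow 2).add
    (((((hasDerivAt_id x).pow 2).const_sub 1).mul ((hd (k + 1) x).pow 2)).div_const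
      ((m : ℝ) ^ 2 - k ^ 2))
  refine monotoneOn_of_hasDerivWithinAt_nonneg (convex_Ici 0)
    (fun x _ => (hderiv x).continuousAt.continuousWithinAt)
    (fun x _ => (hderiv x).hasDerivWithinAt) fun x hx => ?_
  rw [interior_Ici, Set.mem_Ioi] at hx
  have hode := Chebyshev.one_sub_X_sq_mul_iterate_derivative_T_eval (R := ℝ) m k x
  have hnonneg : 0 ≤ 4 * k * x * (derivative^[k + 1] (Chebyshev.T ℝ m)).eval x ^ 2 /
      ((m : ℝ) ^ 2 - k ^ 2) := by positivity
  refine hnonneg.trans_eq ?_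
  simp only [id, Pi.pow_apply]
  field_simp
  push_cast
  linear_combination (-2 * (derivative^[k + 1] (Chebyshev.T ℝ m)).eval x) * hode

/-- At the largest critical point of `T_n^{(k)}`, the value of `T_n^{(k)}` is nonpositive. -/
lemma iterate_derivative_T_eval_nonpos_of_largest_root {n k : ℕ} (hn : k + 1 ≤ n) {ω : ℝ}
    (hroot : (derivative^[k + 1] (Chebyshev.T ℝ (n : ℤ))).eval ω = 0)
    (hmax : ∀ x : ℝ, (derivative^[k + 1] (Chebyshev.T ℝ (n : ℤ))).eval x = 0 → x ≤ ω)
    (hω0 : 0 ≤ ω) (hω1 : ω < 1) :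
    (derivative^[k] (Chebyshev.T ℝ (n : ℤ))).eval ω ≤ 0 := by
  have hpos : ∀ x ∈ Set.Ioo ω 1, 0 ≤ (derivative^[k + 1] (Chebyshev.T ℝ (n : ℤ))).eval x := by
    intro x hx
    by_contra! hneg
    obtain ⟨y, hy, hy0⟩ := intermediate_value_Icc hx.2.le
      (Polynomial.continuous (derivative^[k + 1] (Chebyshev.T ℝ (n : ℤ)))).continuousOn
      ⟨hneg.le, (iterate_derivative_T_eval_pos n (k + 1) hn le_rfl).le⟩
    exact absurd (hmax y hy0) (not_le.mpr (hx.1.trans_le hy.1))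
  have hsecond : 0 ≤ (derivative^[k + 2] (Chebyshev.T ℝ (n : ℤ))).eval ω := by
    have hd := (Polynomial.hasDerivAt (derivative^[k + 1] (Chebyshev.T ℝ (n : ℤ))) ω)
    rw [← Function.iterate_succ_apply' derivative] at hd
    have hslope := (hasDerivWithinAt_iff_tendsto_slope' (s := Set.Ioi ω)
      (by simp)).mp hd.hasDerivWithinAt
    refine ge_of_tendsto hslope ?_
    filter_upwards [Ioo_mem_nhdsGT hω1] with x hx
    rw [slope_def_field, hroot, sub_zero]
    exact div_nonneg (hpos x hx) (sub_nonneg.mpr hx.1.le)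
  have hode := Chebyshev.one_sub_X_sq_mul_iterate_derivative_T_eval (R := ℝ) n k ω
  rw [hroot] at hode
  have hkn : (k : ℝ) + 1 ≤ n := by exact_mod_cast hn
  have hcoef : (0 : ℝ) < (n : ℝ) ^ 2 - k ^ 2 := by
    nlinarith [(Nat.cast_nonneg k : (0 : ℝ) ≤ k)]
  have hω2 : 0 ≤ 1 - ω ^ 2 := by nlinarith
  have := mul_nonneg hω2 hsecond
  push_cast at hode
  by_contra! h
  have := mul_pos hcoef h
  linarith

lemma sq_prod_mul_le_sq_prod_mul (c : ℝ) (k : ℕ) (hc : 2 * (k : ℝ) ≤ c + 1) :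
    (∏ j ∈ Icc 1 k, (c + 1 - 2 * (j : ℝ))) ^ 2 * (c + 1) ≤
      (∏ j ∈ Icc 1 k, (c + 2 - 2 * (j : ℝ))) ^ 2 * (c + 1 - 2 * k) := by
  induction k with
  | zero => simp
  | succ k ih =>
    rw [prod_Icc_succ_top (by omega), prod_Icc_succ_top (by omega)]
    push_cast at hc ⊢
    have ih' := ih (by linarith)
    set N := ∏ j ∈ Icc 1 k, (c + 2 - 2 * (j : ℝ))
    set D := ∏ j ∈ Icc 1 k, (c + 1 - 2 * (j : ℝ))
    have hstep := mul_le_mul_of_nonneg_right ih' (sq_nonneg (c + 1 - 2 * ((k : ℝ) + 1)))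
    have hN : 0 ≤ N ^ 2 * (c + 1 - 2 * ((k : ℝ) + 1)) :=
      mul_nonneg (sq_nonneg N) (by linarith)
    linear_combination hstep + hN

theorem stmt4 (n k : ℕ) (hk : 1 ≤ k) (hn : k + 1 < n) (ω ω' : ℝ)
    (hωroot : (derivative^[k + 1] (Chebyshev.T ℝ (n : ℤ))).eval ω = 0)
    (hωmax : ∀ x : ℝ, (derivative^[k + 1] (Chebyshev.T ℝ (n : ℤ))).eval x = 0 → x ≤ ω)
    (hω'root : (derivative^[k + 1] (Chebyshev.T ℝ ((n : ℤ) + 1))).eval ω' = 0)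
    (hω'max : ∀ x : ℝ, (derivative^[k + 1] (Chebyshev.T ℝ ((n : ℤ) + 1))).eval x = 0 → x ≤ ω') :
    (|(derivative^[k] (Chebyshev.T ℝ (n : ℤ))).eval ω| /
        (derivative^[k] (Chebyshev.T ℝ (n : ℤ))).eval 1) /
      (|(derivative^[k] (Chebyshev.T ℝ ((n : ℤ) + 1))).eval ω'| /
        (derivative^[k] (Chebyshev.T ℝ ((n : ℤ) + 1))).eval 1) ≤
    (∏ j ∈ Finset.Icc 1 k, ((n : ℝ) + (k : ℝ) + 2 - 2 * (j : ℝ))) /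
      (∏ j ∈ Finset.Icc 1 k, ((n : ℝ) + (k : ℝ) + 1 - 2 * (j : ℝ))) := by
  have hkn : (k : ℝ) + 1 < n := by exact_mod_cast hn
  have hk0 : (0 : ℝ) ≤ k := Nat.cast_nonneg k
  have hn0 : (0 : ℝ) < n := by linarith
  have hω0 : 0 ≤ ω := by
    linarith [hωmax _ (iterate_derivative_T_eval_neg_eq_zero hωroot)]
  have hω1 : ω < 1 := by
    by_contra! h
    exact (iterate_derivative_T_eval_pos n (k + 1) (by omega) h).ne' hωroot
  have hFω := iterate_derivative_T_eval_nonpos_of_largest_root hn.le hωroot hωmax hω0 hω1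
  have hF1 := iterate_derivative_T_eval_pos n k (by omega) (le_refl (1 : ℝ))
  have hG1 := iterate_derivative_T_eval_pos (n + 1) k (by omega) (le_refl (1 : ℝ))
  have hG'1 := iterate_derivative_T_eval_pos (n + 1) (k + 1) (by omega) (le_refl (1 : ℝ))
  have hrecω := mul_iterate_derivative_T_add_one_eval (n : ℤ) k ω
  have hrecω' := add_one_mul_iterate_derivative_T_eval (n : ℤ) k ω
  have hrec1 := mul_iterate_derivative_T_add_one_eval (n : ℤ) k 1
  have hrec1' := add_one_mul_iterate_derivative_T_eval (n : ℤ) k 1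
  rw [hωroot] at hrecω hrecω'
  push_cast at hrecω hrecω' hrec1 hrec1' hG1 hG'1
  have hωω' : ω ≤ ω' := by
    have hG'ω : (derivative^[k + 1] (Chebyshev.T ℝ ((n : ℤ) + 1))).eval ω ≤ 0 := by
      have := mul_nonpos_of_nonneg_of_nonpos
        (by positivity : (0 : ℝ) ≤ (n + 1) * (n + k)) hFω
      refine nonpos_of_mul_nonpos_right (a := (n : ℝ)) ?_ hn0
      linarith
    obtain ⟨y, hy, hy0⟩ := intermediate_value_Icc hω1.le
      (Polynomial.continuous (derivative^[k + 1] (Chebyshev.T ℝ ((n : ℤ) + 1)))).continuousOn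
      ⟨hG'ω, hG'1.le⟩
    exact hy.1.trans (hω'max y hy0)
  have hK : (0 : ℝ) < (((n : ℤ) + 1 : ℤ) : ℝ) ^ 2 - k ^ 2 := by
    push_cast
    nlinarith
  have hsonin := monotoneOn_sonin_iterate_derivative_T ((n : ℤ) + 1) k hK
    (Set.mem_Ici.mpr hω0) (Set.mem_Ici.mpr (hω0.trans hωω')) hωω'
  simp only [hω'root] at hsonin
  have hprod := sq_prod_mul_le_sq_prod_mul ((n : ℝ) + k) k (by linarith)
  have hD : 0 < ∏ j ∈ Icc 1 k, ((n : ℝ) + (k : ℝ) + 1 - 2 * (j : ℝ)) := by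
    refine prod_pos fun j hj => ?_
    have : (j : ℝ) ≤ k := by exact_mod_cast (mem_Icc.mp hj).2
    linarith
  have hN : 0 ≤ ∏ j ∈ Icc 1 k, ((n : ℝ) + (k : ℝ) + 2 - 2 * (j : ℝ)) := by
    refine prod_nonneg fun j hj => ?_
    have : (j : ℝ) ≤ k := by exact_mod_cast (mem_Icc.mp hj).2
    linarith
  set F := (derivative^[k] (Chebyshev.T ℝ (n : ℤ))).eval ω
  set F₁ := (derivative^[k] (Chebyshev.T ℝ (n : ℤ))).eval 1
  set G := (derivative^[k] (Chebyshev.T ℝ ((n : ℤ) + 1))).eval ω'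
  set G₁ := (derivative^[k] (Chebyshev.T ℝ ((n : ℤ) + 1))).eval 1
  set Gω := (derivative^[k] (Chebyshev.T ℝ ((n : ℤ) + 1))).eval ω
  set dG := (derivative^[k + 1] (Chebyshev.T ℝ ((n : ℤ) + 1))).eval ω
  set N := ∏ j ∈ Icc 1 k, ((n : ℝ) + (k : ℝ) + 2 - 2 * (j : ℝ))
  set D := ∏ j ∈ Icc 1 k, ((n : ℝ) + (k : ℝ) + 1 - 2 * (j : ℝ))
  have ha : (0 : ℝ) < n + 1 - k := by linarith
  have hb : (0 : ℝ) < n + 1 + k := by linarith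
  have hG₁ : (n : ℝ) * ((n + 1 - k) * G₁) = (n + 1) * (n + k) * F₁ := by
    linear_combination hrec1 + hrec1'
  have hGω : ω * dG = (n + 1 - k) * Gω := by
    have h : (n : ℝ) * (ω * dG) = n * ((n + 1 - k) * Gω) := by linear_combination -hrecω'
    exact mul_left_cancel₀ hn0.ne' h
  have hbound : dG ^ 2 ≤ (n + 1 - k) * (n + 1 + k) * G ^ 2 := by
    have hKab : (((n : ℤ) + 1 : ℤ) : ℝ) ^ 2 - k ^ 2 = (n + 1 - k) * (n + 1 + k) := by
      push_cast
      ring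
    rw [hKab] at hsonin
    have h := mul_le_mul_of_nonneg_left hsonin (mul_pos ha hb).le
    rw [mul_add, mul_div_cancel₀ _ (mul_pos ha hb).ne'] at h
    have hnonneg : 0 ≤ 2 * k * ((n + 1 - k) * Gω ^ 2) := by positivity
    linear_combination h + hnonneg + (ω * dG + (n + 1 - k) * Gω) * hGω
  have hratio : F * G₁ * (n + 1 - k) = dG * F₁ := by
    have h : (n : ℝ) * (F * G₁ * (n + 1 - k)) = n * (dG * F₁) := by
      linear_combination F * hG₁ - F₁ * hrecω
    exact mul_left_cancel₀ hn0.ne' h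
  have hdG : |dG| * D ≤ N * |G| * (n + 1 - k) := by
    refine abs_le_of_sq_le_sq' ?_ (by positivity) |>.2
    rw [mul_pow, mul_pow, mul_pow, sq_abs, sq_abs]
    have h₁ := mul_le_mul_of_nonneg_right hbound (sq_nonneg D)
    have h₂ := mul_le_mul_of_nonneg_right hprod (mul_nonneg ha.le (sq_nonneg G))
    linear_combination h₁ + h₂
  have hratio_abs : |F| * G₁ * (n + 1 - k) = |dG| * F₁ := by
    have h := congr_arg abs hratio
    rwa [abs_mul, abs_mul, abs_mul, abs_of_pos ha, abs_of_pos hG1, abs_of_pos hF1] at h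
  rw [div_div_div_eq]
  refine div_le_of_le_mul₀ (by positivity) (by positivity) ?_
  rw [div_mul_eq_mul_div, le_div_iff₀ hD]
  refine le_of_mul_le_mul_right ?_ ha
  have h := mul_le_mul_of_nonneg_right hdG hF1.le
  linear_combination h + D * hratio_abs
end
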